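/- Let f be an orientation preserving circle homeomorphism with a fixed point. Then f is strongly reversible in the full homeomorphism group Homeo(S¹) if and only if there exists a homeomorphism h of the circle such that Δ_f = −deg(h)·(Δ_f ∘ h), where either h preserves orientation and has rotation number 1/2, or h reverses orientation. -/

import Mathlib

noncomputable section

open scoped Classical

local instance : Fact ((0:ℝ) < 1) := ⟨zero_lt_one⟩

/-- The circle `S¹`, realised as `ℝ / ℤ`. -/
abbrev S1 := AddCircle (1 : ℝ)

/-- `F` is a (monotone, degree one) lift of the circle homeomorphism `f`. -/
def IsLiftOf (f : S1 ≃ₜ S1) (F : CircleDeg1Lift) : Prop :=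
  ∀ x : ℝ, f (x : S1) = ((F x : ℝ) : S1)

/-- A circle homeomorphism is orientation preserving iff it admits a monotone degree one lift. -/
def OrientationPreserving (f : S1 ≃ₜ S1) : Prop :=
  ∃ F : CircleDeg1Lift, IsLiftOf f F

/-- A circle homeomorphism is orientation reversing iff it admits a strictly decreasing
degree `-1` lift. -/
def OrientationReversing (f : S1 ≃ₜ S1) : Prop :=
  ∃ F : ℝ → ℝ, StrictAnti F ∧ (∀ x : ℝ, F (x + 1) = F x - 1) ∧
    ∀ x : ℝ, f (x : S1) = ((F x : ℝ) : S1)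

/-- `f` has (Poincaré) rotation number `r` (mod 1): some lift has translation number `r`. -/
def HasRotationNumber (f : S1 ≃ₜ S1) (r : ℝ) : Prop :=
  ∃ F : CircleDeg1Lift, IsLiftOf f F ∧ F.translationNumber = r

/-- An involution. -/
def IsInvolution (f : S1 ≃ₜ S1) : Prop := ∀ x, f (f x) = x

/-- The canonical representative of a point of the circle in `[0, 1)`. -/
def rep (x : S1) : ℝ := (AddCircle.equivIco 1 0 x : ℝ)

/-- The signature of a circle homeomorphism with respect to a lift `F`; when `F` is the
(unique) lift with a fixed point of an orientation preserving homeomorphism with a fixed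
point, this is the signature function `Δ_f : S¹ → {-1, 0, 1}`. -/
def signature (F : CircleDeg1Lift) (x : S1) : ℝ := Real.sign (F (rep x) - rep x)

/-- Strong reversibility in `Homeo⁺(S¹)`. -/
def StronglyReversiblePlus (f : S1 ≃ₜ S1) : Prop :=
  ∃ σ : S1 ≃ₜ S1, OrientationPreserving σ ∧ IsInvolution σ ∧ ∀ x, σ (f (σ x)) = f.symm x

/-- Strong reversibility in the full group `Homeo(S¹)`. -/
def StronglyReversible (f : S1 ≃ₜ S1) : Prop :=
  ∃ τ : S1 ≃ₜ S1, IsInvolution τ ∧ ∀ x, τ (f (τ x)) = f.symm x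

lemma map_add_intCast {T : ℝ → ℝ} {d : ℝ} (hT : ∀ x, T (x + 1) = T x + d) (x : ℝ) (k : ℤ) :
    T (x + k) = T x + k * d := by
  induction k using Int.induction_on with
  | zero => simp
  | succ k ih =>
    have := hT (x + k)
    push_cast at *
    rw [← add_assoc, this, ih]; ring
  | pred k ih =>
    have := hT (x + (-k - 1))
    push_cast at *
    rw [show x + (-(k : ℝ) - 1) + 1 = x + -k by ring, ih] at this
    linarith

lemma OrderIso.zpow_add_one_apply (F : ℝ ≃o ℝ) (n : ℤ) (x : ℝ) :
    (F ^ (n + 1)) x = (F ^ n) (F x) := by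
  rw [zpow_add_one]; rfl

lemma OrderIso.zpow_one_add_apply (F : ℝ ≃o ℝ) (n : ℤ) (x : ℝ) :
    (F ^ (n + 1)) x = F ((F ^ n) x) := by
  rw [add_comm, zpow_one_add]; rfl

lemma OrderIso.zpow_apply_add_one {F : ℝ ≃o ℝ} (hF : ∀ x, F (x + 1) = F x + 1) (n : ℤ) (x : ℝ) :
    (F ^ n) (x + 1) = (F ^ n) x + 1 := by
  have h : Commute F (OrderIso.addRight (1 : ℝ)) := OrderIso.ext (funext hF)
  exact DFunLike.congr_fun (h.zpow_left n) x

lemma OrderIso.zpow_apply_eq_self {F : ℝ ≃o ℝ} {x : ℝ} (hx : F x = x) (n : ℤ) :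
    (F ^ n) x = x := by
  induction n using Int.induction_on with
  | zero => rfl
  | succ k ih => rw [F.zpow_add_one_apply, hx, ih]
  | pred k ih =>
    have := F.zpow_add_one_apply (-(k : ℤ) - 1) x
    rwa [hx, sub_add_cancel, ih, eq_comm] at this

/-- The curve through `u` which interpolates affinely between `u` and `F u` and satisfies
`orbitCurve F u (t + 1) = F (orbitCurve F u t)`. -/
def orbitCurve (F : ℝ ≃o ℝ) (u t : ℝ) : ℝ :=
  (F ^ ⌊t⌋) (u + Int.fract t * (F u - u))

lemma orbitCurve_add_one (F : ℝ ≃o ℝ) (u t : ℝ) :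
    orbitCurve F u (t + 1) = F (orbitCurve F u t) := by
  simp [orbitCurve, OrderIso.zpow_one_add_apply]

lemma orbitCurve_translate {F : ℝ ≃o ℝ} (hF : ∀ x, F (x + 1) = F x + 1) (u t : ℝ) :
    orbitCurve F (u + 1) t = orbitCurve F u t + 1 := by
  rw [orbitCurve, orbitCurve, ← OrderIso.zpow_apply_add_one hF, hF]
  congr 1; ring

lemma orbitCurve_strictMono {F : ℝ ≃o ℝ} {u : ℝ} (hu : u < F u) :
    StrictMono (orbitCurve F u) := by
  have hmono : Monotone fun n : ℤ ↦ (F ^ n) u := monotone_int_of_le_succ fun n ↦ by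
    rw [F.zpow_add_one_apply]; exact (F ^ n).monotone hu.le
  intro s t hst
  rcases (Int.floor_mono hst.le).eq_or_lt with h | h
  · rw [orbitCurve, orbitCurve, h]
    refine (F ^ ⌊t⌋).strictMono ?_
    have : Int.fract s < Int.fract t := by
      rw [Int.fract, Int.fract, h]; linarith
    nlinarith
  · calc orbitCurve F u s < (F ^ (⌊s⌋ + 1)) u := by
          rw [F.zpow_add_one_apply]
          refine (F ^ ⌊s⌋).strictMono ?_
          nlinarith [Int.fract_lt_one s]
      _ ≤ (F ^ ⌊t⌋) u := hmono h
      _ ≤ orbitCurve F u t := (F ^ ⌊t⌋).monotone (by nlinarith [Int.fract_nonneg t])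

lemma orbitCurve_mem_Ioo {F : ℝ ≃o ℝ} {a b u : ℝ} (ha : F a = a) (hb : F b = b)
    (hu : u ∈ Set.Ioo a b) (t : ℝ) : orbitCurve F u t ∈ Set.Ioo a b := by
  have h1 : a < F u := by rw [← ha]; exact F.strictMono hu.1
  have h2 : F u < b := by rw [← hb]; exact F.strictMono hu.2
  have h3 := Int.fract_nonneg t
  have h4 := Int.fract_lt_one t
  have h5 := hu.1
  have h6 := hu.2
  constructor
  · rw [← OrderIso.zpow_apply_eq_self ha ⌊t⌋]
    exact (F ^ ⌊t⌋).strictMono (by nlinarith)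
  · rw [← OrderIso.zpow_apply_eq_self hb ⌊t⌋]
    exact (F ^ ⌊t⌋).strictMono (by nlinarith)

lemma exists_zpow_apply_le {F : ℝ ≃o ℝ} {a b u x : ℝ}
    (hab : ∀ z ∈ Set.Ioo a b, F z ≠ z) (hu : u ∈ Set.Ioo a b) (hx : x ∈ Set.Ioo a b) :
    ∃ n : ℤ, (F ^ n) u ≤ x := by
  by_contra! h
  have hbdd : BddBelow (Set.range fun n : ℤ ↦ (F ^ n) u) :=
    ⟨x, by rintro _ ⟨n, rfl⟩; exact (h n).le⟩
  refine hab (⨅ n : ℤ, (F ^ n) u) ⟨hx.1.trans_le (le_ciInf fun n ↦ (h n).le),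
    (ciInf_le hbdd 0).trans_lt hu.2⟩ ?_
  rw [F.map_ciInf hbdd, ← (Equiv.addRight (1 : ℤ)).iInf_comp (g := fun n ↦ (F ^ n) u)]
  simp [OrderIso.zpow_one_add_apply]

lemma exists_le_zpow_apply {F : ℝ ≃o ℝ} {a b u x : ℝ}
    (hab : ∀ z ∈ Set.Ioo a b, F z ≠ z) (hu : u ∈ Set.Ioo a b) (hx : x ∈ Set.Ioo a b) :
    ∃ n : ℤ, x < (F ^ n) u := by
  by_contra! h
  have hbdd : BddAbove (Set.range fun n : ℤ ↦ (F ^ n) u) :=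
    ⟨x, by rintro _ ⟨n, rfl⟩; exact h n⟩
  refine hab (⨆ n : ℤ, (F ^ n) u) ⟨hu.1.trans_le (le_ciSup hbdd 0),
    (ciSup_le h).trans_lt hx.2⟩ ?_
  rw [F.map_ciSup hbdd, ← (Equiv.addRight (1 : ℤ)).iSup_comp (g := fun n ↦ (F ^ n) u)]
  simp [OrderIso.zpow_one_add_apply]

lemma exists_orbitCurve_eq_of_lt {F : ℝ ≃o ℝ} {a b u x : ℝ}
    (hab : ∀ z ∈ Set.Ioo a b, F z ≠ z) (hu : u ∈ Set.Ioo a b) (hx : x ∈ Set.Ioo a b)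
    (huF : u < F u) : ∃ t, orbitCurve F u t = x := by
  have hmono : Monotone fun n : ℤ ↦ (F ^ n) u := monotone_int_of_le_succ fun n ↦ by
    rw [F.zpow_add_one_apply]; exact (F ^ n).monotone huF.le
  obtain ⟨N, hN⟩ := exists_le_zpow_apply hab hu hx
  obtain ⟨n, hn, hmax⟩ := Int.exists_greatest_of_bdd (P := fun n ↦ (F ^ n) u ≤ x)
    ⟨N, fun n hn ↦ le_of_not_ge fun h ↦ (hn.trans_lt hN).not_ge (hmono h)⟩
    (exists_zpow_apply_le hab hu hx)
  have hlt : x < (F ^ n) (F u) := by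
    rw [← F.zpow_add_one_apply]
    exact lt_of_not_ge fun h ↦ (lt_add_one n).not_ge (hmax _ h)
  obtain ⟨y, rfl⟩ := (F ^ n).surjective x
  rw [(F ^ n).le_iff_le] at hn
  rw [(F ^ n).lt_iff_lt] at hlt
  have h0 : 0 ≤ (y - u) / (F u - u) := div_nonneg (by linarith) (by linarith)
  have h1 : (y - u) / (F u - u) < 1 := (div_lt_one (by linarith)).2 (by linarith)
  refine ⟨n + (y - u) / (F u - u), ?_⟩
  have hfl : ⌊(n : ℝ) + (y - u) / (F u - u)⌋ = n := by
    rw [Int.floor_intCast_add, Int.floor_eq_zero_iff.2 ⟨h0, h1⟩, add_zero]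
  rw [orbitCurve, Int.fract, hfl, add_sub_cancel_left, div_mul_cancel₀ _ (by linarith)]
  congr 1; ring

/-- The conjugate of an order isomorphism of the line by `x ↦ -x`. -/
def OrderIso.negConj (F : ℝ ≃o ℝ) : ℝ ≃o ℝ :=
  (OrderIso.neg ℝ).trans (F.dual.trans (OrderIso.neg ℝ).symm)

lemma OrderIso.negConj_apply (F : ℝ ≃o ℝ) (x : ℝ) : F.negConj x = -F (-x) := rfl

lemma OrderIso.negConj_zpow_apply (F : ℝ ≃o ℝ) (n : ℤ) (x : ℝ) :
    (F.negConj ^ n) x = -(F ^ n) (-x) := by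
  induction n using Int.induction_on generalizing x with
  | zero => simp
  | succ k ih => rw [zpow_add_one_apply, ih, zpow_add_one_apply, negConj_apply, neg_neg]
  | pred k ih =>
    obtain ⟨y, rfl⟩ := F.negConj.surjective x
    rw [← zpow_add_one_apply, sub_add_cancel, ih, negConj_apply, neg_neg, ← zpow_add_one_apply,
      sub_add_cancel]

lemma orbitCurve_negConj (F : ℝ ≃o ℝ) (u t : ℝ) :
    orbitCurve F.negConj (-u) t = -orbitCurve F u t := by
  rw [orbitCurve, OrderIso.negConj_zpow_apply, OrderIso.negConj_apply, orbitCurve, neg_neg]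
  congr 2; ring

lemma orbitCurve_strictAnti {F : ℝ ≃o ℝ} {u : ℝ} (hu : F u < u) :
    StrictAnti (orbitCurve F u) := by
  intro s t hst
  have := orbitCurve_strictMono (F := F.negConj) (u := -u)
    (by rw [F.negConj_apply, neg_neg]; linarith) hst
  rw [orbitCurve_negConj, orbitCurve_negConj] at this
  linarith

lemma orbitCurve_injective {F : ℝ ≃o ℝ} {u : ℝ} (hu : F u ≠ u) :
    Function.Injective (orbitCurve F u) :=
  hu.lt_or_gt.elim (fun h ↦ (orbitCurve_strictAnti h).injective)
    fun h ↦ (orbitCurve_strictMono h).injective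

lemma exists_orbitCurve_eq {F : ℝ ≃o ℝ} {a b u x : ℝ}
    (hab : ∀ z ∈ Set.Ioo a b, F z ≠ z) (hu : u ∈ Set.Ioo a b) (hx : x ∈ Set.Ioo a b) :
    ∃ t, orbitCurve F u t = x := by
  rcases (hab u hu).lt_or_gt with h | h
  · have hab' : ∀ z ∈ Set.Ioo (-b) (-a), F.negConj z ≠ z := fun z hz h ↦ by
      rw [F.negConj_apply] at h
      exact hab (-z) ⟨lt_neg.1 hz.2, neg_lt.1 hz.1⟩ (by linarith)
    obtain ⟨t, ht⟩ := exists_orbitCurve_eq_of_lt (u := -u) (x := -x) hab'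
      ⟨neg_lt_neg hu.2, neg_lt_neg hu.1⟩ ⟨neg_lt_neg hx.2, neg_lt_neg hx.1⟩
      (by rw [F.negConj_apply, neg_neg]; linarith)
    exact ⟨t, by rw [orbitCurve_negConj] at ht; linarith⟩
  · exact exists_orbitCurve_eq_of_lt hab hu hx h

/-- No fixed point of `F` lies between `x` and `y`: these points belong to the same component of
the complement of the fixed point set. -/
def SameGap (F : ℝ → ℝ) (x y : ℝ) : Prop := ∀ z ∈ Set.uIcc x y, F z ≠ z

lemma SameGap.left {F : ℝ → ℝ} {x y : ℝ} (h : SameGap F x y) : F x ≠ x := h x Set.left_mem_uIcc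

lemma SameGap.right {F : ℝ → ℝ} {x y : ℝ} (h : SameGap F x y) : F y ≠ y := h y Set.right_mem_uIcc

lemma SameGap.lt_iff {F : ℝ → ℝ} {x y z : ℝ} (h : SameGap F x y) (hz : F z = z) :
    x < z ↔ y < z := by
  constructor <;> intro h1 <;> by_contra! h2
  · exact h z (Set.mem_uIcc.2 (Or.inl ⟨h1.le, h2⟩)) hz
  · exact h z (Set.mem_uIcc.2 (Or.inr ⟨h1.le, h2⟩)) hz

lemma SameGap.gt_iff {F : ℝ → ℝ} {x y z : ℝ} (h : SameGap F x y) (hz : F z = z) :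
    z < x ↔ z < y := by
  constructor <;> intro h1 <;> by_contra! h2
  · exact h z (Set.mem_uIcc.2 (Or.inr ⟨h2, h1.le⟩)) hz
  · exact h z (Set.mem_uIcc.2 (Or.inl ⟨h2, h1.le⟩)) hz

/-- The largest fixed point of `F` to the left of `x`. -/
def gapLeft (F : ℝ → ℝ) (x : ℝ) : ℝ := sSup {z | F z = z ∧ z ≤ x}

/-- The smallest fixed point of `F` to the right of `x`. -/
def gapRight (F : ℝ → ℝ) (x : ℝ) : ℝ := sInf {z | F z = z ∧ x ≤ z}

/-- The midpoint of the component of `x` in the complement of the fixed point set of `F`. -/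
def gapMid (F : ℝ → ℝ) (x : ℝ) : ℝ := (gapLeft F x + gapRight F x) / 2

lemma SameGap.gapMid_eq {F : ℝ → ℝ} {x y : ℝ} (h : SameGap F x y) : gapMid F x = gapMid F y := by
  have h1 : {z | F z = z ∧ z ≤ x} = {z | F z = z ∧ z ≤ y} := by
    ext z
    refine and_congr_right fun hz ↦ ?_
    simpa using (h.lt_iff hz).not
  have h2 : {z | F z = z ∧ x ≤ z} = {z | F z = z ∧ y ≤ z} := by
    ext z
    refine and_congr_right fun hz ↦ ?_
    simpa using (h.gt_iff hz).not
  rw [gapMid, gapMid, gapLeft, gapLeft, gapRight, gapRight, h1, h2]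

lemma isGreatest_gapLeft {F : ℝ → ℝ} (hF : Continuous F) (hF1 : ∀ x, F (x + 1) = F x + 1)
    (hfix : ∃ p, F p = p) (x : ℝ) : IsGreatest {z | F z = z ∧ z ≤ x} (gapLeft F x) := by
  obtain ⟨p, hp⟩ := hfix
  have hc : IsClosed {z | F z = z ∧ z ≤ x} :=
    (isClosed_eq hF continuous_id).inter isClosed_Iic
  have hb : BddAbove {z | F z = z ∧ z ≤ x} := ⟨x, fun z hz ↦ hz.2⟩
  refine ⟨hc.csSup_mem ⟨p + ⌊x - p⌋, ?_, ?_⟩ hb, fun z hz ↦ le_csSup hb hz⟩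
  · rw [map_add_intCast hF1, hp, mul_one]
  · linarith [Int.floor_le (x - p)]

lemma isLeast_gapRight {F : ℝ → ℝ} (hF : Continuous F) (hF1 : ∀ x, F (x + 1) = F x + 1)
    (hfix : ∃ p, F p = p) (x : ℝ) : IsLeast {z | F z = z ∧ x ≤ z} (gapRight F x) := by
  obtain ⟨p, hp⟩ := hfix
  have hc : IsClosed {z | F z = z ∧ x ≤ z} :=
    (isClosed_eq hF continuous_id).inter isClosed_Ici
  have hb : BddBelow {z | F z = z ∧ x ≤ z} := ⟨x, fun z hz ↦ hz.2⟩
  refine ⟨hc.csInf_mem ⟨p + ⌈x - p⌉, ?_, ?_⟩ hb, fun z hz ↦ csInf_le hb hz⟩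
  · rw [map_add_intCast hF1, hp, mul_one]
  · linarith [Int.le_ceil (x - p)]

lemma gapMid_add_one {F : ℝ → ℝ} (hF : Continuous F) (hF1 : ∀ x, F (x + 1) = F x + 1)
    (hfix : ∃ p, F p = p) (x : ℝ) : gapMid F (x + 1) = gapMid F x + 1 := by
  have hsub (z : ℝ) (hz : F z = z) : F (z - 1) = z - 1 := by
    have := hF1 (z - 1)
    rw [sub_add_cancel] at this
    linarith
  have hl := isGreatest_gapLeft hF hF1 hfix x
  have hr := isLeast_gapRight hF hF1 hfix x
  have h1 : gapLeft F (x + 1) = gapLeft F x + 1 :=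
    (isGreatest_gapLeft hF hF1 hfix (x + 1)).unique
      ⟨⟨by rw [hF1, hl.1.1], by linarith [hl.1.2]⟩,
        fun z hz ↦ by linarith [hl.2 ⟨hsub z hz.1, by linarith [hz.2]⟩]⟩
  have h2 : gapRight F (x + 1) = gapRight F x + 1 :=
    (isLeast_gapRight hF hF1 hfix (x + 1)).unique
      ⟨⟨by rw [hF1, hr.1.1], by linarith [hr.1.2]⟩,
        fun z hz ↦ by linarith [hr.2 ⟨hsub z hz.1, by linarith [hz.2]⟩]⟩
  rw [gapMid, gapMid, h1, h2]; ring

lemma mem_Ioo_gap {F : ℝ → ℝ} (hF : Continuous F) (hF1 : ∀ x, F (x + 1) = F x + 1)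
    (hfix : ∃ p, F p = p) {x : ℝ} (hx : F x ≠ x) : x ∈ Set.Ioo (gapLeft F x) (gapRight F x) := by
  have hl := (isGreatest_gapLeft hF hF1 hfix x).1
  have hr := (isLeast_gapRight hF hF1 hfix x).1
  exact ⟨hl.2.lt_of_ne fun h ↦ hx (h ▸ hl.1), hr.2.lt_of_ne fun h ↦ hx (h ▸ hr.1)⟩

lemma ne_of_mem_Ioo_gap {F : ℝ → ℝ} (hF : Continuous F) (hF1 : ∀ x, F (x + 1) = F x + 1)
    (hfix : ∃ p, F p = p) {x z : ℝ} (hz : z ∈ Set.Ioo (gapLeft F x) (gapRight F x)) : F z ≠ z := by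
  intro h
  rcases le_total z x with hzx | hzx
  · exact hz.1.not_ge ((isGreatest_gapLeft hF hF1 hfix x).2 ⟨h, hzx⟩)
  · exact hz.2.not_ge ((isLeast_gapRight hF hF1 hfix x).2 ⟨h, hzx⟩)

lemma sameGap_of_mem_Ioo {F : ℝ → ℝ} (hF : Continuous F) (hF1 : ∀ x, F (x + 1) = F x + 1)
    (hfix : ∃ p, F p = p) {x y : ℝ} (hx : F x ≠ x)
    (hy : y ∈ Set.Ioo (gapLeft F x) (gapRight F x)) : SameGap F x y := fun _ hz ↦
  ne_of_mem_Ioo_gap hF hF1 hfix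
    (Set.ordConnected_Ioo.uIcc_subset (mem_Ioo_gap hF hF1 hfix hx) hy hz)

lemma gapMid_mem_Ioo {F : ℝ → ℝ} (hF : Continuous F) (hF1 : ∀ x, F (x + 1) = F x + 1)
    (hfix : ∃ p, F p = p) {x : ℝ} (hx : F x ≠ x) :
    gapMid F x ∈ Set.Ioo (gapLeft F x) (gapRight F x) := by
  have := mem_Ioo_gap hF hF1 hfix hx
  constructor <;> rw [gapMid] <;> linarith [this.1, this.2]

lemma sameGap_orbitCurve {F : ℝ ≃o ℝ} (hF1 : ∀ x, F (x + 1) = F x + 1) (hfix : ∃ p, F p = p)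
    {x : ℝ} (hx : F x ≠ x) (t : ℝ) : SameGap F x (orbitCurve F (gapMid F x) t) :=
  sameGap_of_mem_Ioo F.continuous hF1 hfix hx <|
    orbitCurve_mem_Ioo (isGreatest_gapLeft F.continuous hF1 hfix x).1.1
      (isLeast_gapRight F.continuous hF1 hfix x).1.1 (gapMid_mem_Ioo F.continuous hF1 hfix hx) t

lemma orbitCurve_gapMid_add_intCast {F : ℝ ≃o ℝ} (hF1 : ∀ x, F (x + 1) = F x + 1)
    (hfix : ∃ p, F p = p) (x t : ℝ) (k : ℤ) :
    orbitCurve F (gapMid F (x + k)) t = orbitCurve F (gapMid F x) t + k := by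
  have h (x : ℝ) : orbitCurve F (gapMid F (x + 1)) t = orbitCurve F (gapMid F x) t + 1 := by
    rw [gapMid_add_one F.continuous hF1 hfix, orbitCurve_translate hF1]
  simpa using map_add_intCast (T := fun x ↦ orbitCurve F (gapMid F x) t) h x k

/-- The parameter of `x` on the orbit curve through the midpoint of its gap. -/
def gapCoord (F : ℝ ≃o ℝ) (x : ℝ) : ℝ := Function.invFun (orbitCurve F (gapMid F x)) x

lemma orbitCurve_gapCoord {F : ℝ ≃o ℝ} (hF1 : ∀ x, F (x + 1) = F x + 1) (hfix : ∃ p, F p = p)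
    {x : ℝ} (hx : F x ≠ x) : orbitCurve F (gapMid F x) (gapCoord F x) = x :=
  Function.invFun_eq <| exists_orbitCurve_eq
    (fun _ hz ↦ ne_of_mem_Ioo_gap F.continuous hF1 hfix hz)
    (gapMid_mem_Ioo F.continuous hF1 hfix hx) (mem_Ioo_gap F.continuous hF1 hfix hx)

lemma gapCoord_eq {F : ℝ ≃o ℝ} (hF1 : ∀ x, F (x + 1) = F x + 1) (hfix : ∃ p, F p = p)
    {x t : ℝ} (hx : F x ≠ x) (ht : orbitCurve F (gapMid F x) t = x) : gapCoord F x = t := by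
  refine orbitCurve_injective ?_ ((orbitCurve_gapCoord hF1 hfix hx).trans ht.symm)
  exact ne_of_mem_Ioo_gap F.continuous hF1 hfix (gapMid_mem_Ioo F.continuous hF1 hfix hx)

lemma orbitCurve_gapMid_strictMono {F : ℝ ≃o ℝ} (hF1 : ∀ x, F (x + 1) = F x + 1)
    (hfix : ∃ p, F p = p) {x : ℝ} (hx : x < F x) : StrictMono (orbitCurve F (gapMid F x)) := by
  have hmid := ne_of_mem_Ioo_gap F.continuous hF1 hfix
    (gapMid_mem_Ioo F.continuous hF1 hfix hx.ne')
  refine hmid.lt_or_gt.elim (fun h ↦ absurd hx ?_) orbitCurve_strictMono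
  have := orbitCurve_strictAnti h (lt_add_one (gapCoord F x))
  rw [orbitCurve_add_one, orbitCurve_gapCoord hF1 hfix hx.ne'] at this
  exact this.not_gt

lemma orbitCurve_gapMid_strictAnti {F : ℝ ≃o ℝ} (hF1 : ∀ x, F (x + 1) = F x + 1)
    (hfix : ∃ p, F p = p) {x : ℝ} (hx : F x < x) : StrictAnti (orbitCurve F (gapMid F x)) := by
  have hmid := ne_of_mem_Ioo_gap F.continuous hF1 hfix
    (gapMid_mem_Ioo F.continuous hF1 hfix hx.ne)
  refine hmid.lt_or_gt.elim orbitCurve_strictAnti fun h ↦ absurd hx ?_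
  have := orbitCurve_strictMono h (lt_add_one (gapCoord F x))
  rw [orbitCurve_add_one, orbitCurve_gapCoord hF1 hfix hx.ne] at this
  exact this.not_gt

/-- The map which agrees with `T` on the fixed points of `F`, and which sends each gap of `F` to
the same gap as `T` does but reverses the parametrization by orbit curves. -/
def gapFlip (F : ℝ ≃o ℝ) (T : ℝ → ℝ) (x : ℝ) : ℝ :=
  if F x = x then T x else orbitCurve F (gapMid F (T x)) (-gapCoord F x)

section GapFlip

variable {F : ℝ ≃o ℝ} {T : ℝ → ℝ}

lemma gapFlip_of_eq {x : ℝ} (hx : F x = x) : gapFlip F T x = T x := if_pos hx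

lemma gapFlip_of_ne {x : ℝ} (hx : F x ≠ x) :
    gapFlip F T x = orbitCurve F (gapMid F (T x)) (-gapCoord F x) := if_neg hx

lemma sameGap_gapFlip (hF1 : ∀ x, F (x + 1) = F x + 1) (hfix : ∃ p, F p = p)
    (hT : ∀ x, F (T x) = T x ↔ F x = x) {x : ℝ} (hx : F x ≠ x) :
    SameGap F (T x) (gapFlip F T x) := by
  rw [gapFlip_of_ne hx]
  exact sameGap_orbitCurve hF1 hfix ((hT x).not.2 hx) _

lemma gapCoord_gapFlip (hF1 : ∀ x, F (x + 1) = F x + 1) (hfix : ∃ p, F p = p)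
    (hT : ∀ x, F (T x) = T x ↔ F x = x) {x : ℝ} (hx : F x ≠ x) :
    gapCoord F (gapFlip F T x) = -gapCoord F x := by
  have h := sameGap_gapFlip hF1 hfix hT hx
  refine gapCoord_eq hF1 hfix h.right ?_
  rw [← h.gapMid_eq, ← gapFlip_of_ne hx]

lemma gapFlip_add_one (hF1 : ∀ x, F (x + 1) = F x + 1) (hfix : ∃ p, F p = p) {d : ℤ}
    (hT1 : ∀ x, T (x + 1) = T x + d) (x : ℝ) :
    gapFlip F T (x + 1) = gapFlip F T x + d := by
  by_cases hx : F x = x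
  · rw [gapFlip_of_eq hx, gapFlip_of_eq (by rw [hF1, hx]), hT1]
  have hx1 : F (x + 1) ≠ x + 1 := by rwa [hF1, ne_eq, add_left_inj]
  have hc : gapCoord F (x + 1) = gapCoord F x := gapCoord_eq hF1 hfix hx1 <| by
    rw [gapMid_add_one F.continuous hF1 hfix, orbitCurve_translate hF1,
      orbitCurve_gapCoord hF1 hfix hx]
  rw [gapFlip_of_ne hx, gapFlip_of_ne hx1, hT1, hc, orbitCurve_gapMid_add_intCast hF1 hfix]

lemma SameGap.map (hTinj : StrictMono T ∨ StrictAnti T) (hTsurj : Function.Surjective T)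
    (hT : ∀ x, F (T x) = T x ↔ F x = x) {x y : ℝ} (h : SameGap F x y) :
    SameGap F (T x) (T y) := by
  intro z hz
  obtain ⟨w, rfl⟩ := hTsurj z
  refine (hT w).not.2 (h w ?_)
  rw [Set.mem_uIcc] at hz ⊢
  rcases hTinj with hm | hm
  · simpa only [hm.le_iff_le] using hz
  · simpa only [hm.le_iff_ge, and_comm, or_comm] using hz

lemma gapFlip_gapFlip (hF1 : ∀ x, F (x + 1) = F x + 1) (hfix : ∃ p, F p = p) {k : ℤ}
    (hTinj : StrictMono T ∨ StrictAnti T) (hT : ∀ x, F (T x) = T x ↔ F x = x)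
    (hTT : ∀ x, T (T x) = x + k) (x : ℝ) : gapFlip F T (gapFlip F T x) = x + k := by
  by_cases hx : F x = x
  · rw [gapFlip_of_eq hx, gapFlip_of_eq ((hT x).2 hx), hTT]
  have hsurj : Function.Surjective T := fun y ↦ ⟨T (y - k), by rw [hTT, sub_add_cancel]⟩
  have h := sameGap_gapFlip hF1 hfix hT hx
  have h2 := h.map hTinj hsurj hT
  rw [gapFlip_of_ne h.right, gapCoord_gapFlip hF1 hfix hT hx, neg_neg, ← h2.gapMid_eq, hTT,
    orbitCurve_gapMid_add_intCast hF1 hfix, orbitCurve_gapCoord hF1 hfix hx]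

lemma apply_gapFlip_apply (hF1 : ∀ x, F (x + 1) = F x + 1) (hfix : ∃ p, F p = p)
    (hTinj : StrictMono T ∨ StrictAnti T) (hTsurj : Function.Surjective T)
    (hT : ∀ x, F (T x) = T x ↔ F x = x) (x : ℝ) :
    F (gapFlip F T (F x)) = gapFlip F T x := by
  by_cases hx : F x = x
  · rw [hx, gapFlip_of_eq hx, (hT x).2 hx]
  have hFx : orbitCurve F (gapMid F x) (gapCoord F x + 1) = F x := by
    rw [orbitCurve_add_one, orbitCurve_gapCoord hF1 hfix hx]
  have h : SameGap F x (F x) := by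
    rw [← hFx]; exact sameGap_orbitCurve hF1 hfix hx _
  have hc : gapCoord F (F x) = gapCoord F x + 1 :=
    gapCoord_eq hF1 hfix h.right (by rw [← h.gapMid_eq, hFx])
  rw [gapFlip_of_ne h.right, gapFlip_of_ne hx, hc, ← (h.map hTinj hTsurj hT).gapMid_eq,
    ← orbitCurve_add_one]
  congr 1; ring

lemma gapFlip_lt (hF1 : ∀ x, F (x + 1) = F x + 1) (hfix : ∃ p, F p = p)
    (hT : ∀ x, F (T x) = T x ↔ F x = x) {x z : ℝ} (hz : F z = z) (h : T x < z) :
    gapFlip F T x < z := by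
  by_cases hx : F x = x
  · rwa [gapFlip_of_eq hx]
  · exact ((sameGap_gapFlip hF1 hfix hT hx).lt_iff hz).1 h

lemma lt_gapFlip (hF1 : ∀ x, F (x + 1) = F x + 1) (hfix : ∃ p, F p = p)
    (hT : ∀ x, F (T x) = T x ↔ F x = x) {x z : ℝ} (hz : F z = z) (h : z < T x) :
    z < gapFlip F T x := by
  by_cases hx : F x = x
  · rwa [gapFlip_of_eq hx]
  · exact ((sameGap_gapFlip hF1 hfix hT hx).gt_iff hz).1 h

lemma gapCoord_lt_gapCoord (hF1 : ∀ x, F (x + 1) = F x + 1) (hfix : ∃ p, F p = p) {x y : ℝ}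
    (h : SameGap F x y) (hxF : x < F x) (hxy : x < y) : gapCoord F x < gapCoord F y := by
  rw [← (orbitCurve_gapMid_strictMono hF1 hfix hxF).lt_iff_lt, orbitCurve_gapCoord hF1 hfix h.left,
    h.gapMid_eq, orbitCurve_gapCoord hF1 hfix h.right]
  exact hxy

lemma gapCoord_lt_gapCoord' (hF1 : ∀ x, F (x + 1) = F x + 1) (hfix : ∃ p, F p = p) {x y : ℝ}
    (h : SameGap F x y) (hxF : F x < x) (hxy : x < y) : gapCoord F y < gapCoord F x := by
  rw [← (orbitCurve_gapMid_strictAnti hF1 hfix hxF).lt_iff_gt, orbitCurve_gapCoord hF1 hfix h.left,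
    h.gapMid_eq, orbitCurve_gapCoord hF1 hfix h.right]
  exact hxy

lemma gapFlip_strictMono (hF1 : ∀ x, F (x + 1) = F x + 1) (hfix : ∃ p, F p = p)
    (hTm : StrictMono T) (hTsurj : Function.Surjective T)
    (hT : ∀ x, F (T x) = T x ↔ F x = x) (hlt : ∀ x, x < F x → F (T x) < T x)
    (hgt : ∀ x, F x < x → T x < F (T x)) : StrictMono (gapFlip F T) := by
  intro x y hxy
  by_cases h : SameGap F x y
  · rw [gapFlip_of_ne h.left, gapFlip_of_ne h.right,
      ← (h.map (Or.inl hTm) hTsurj hT).gapMid_eq]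
    rcases h.left.lt_or_gt with hx | hx
    · exact orbitCurve_gapMid_strictMono hF1 hfix (hgt x hx)
        (neg_lt_neg (gapCoord_lt_gapCoord' hF1 hfix h hx hxy))
    · exact orbitCurve_gapMid_strictAnti hF1 hfix (hlt x hx)
        (neg_lt_neg (gapCoord_lt_gapCoord hF1 hfix h hx hxy))
  · simp only [SameGap, not_forall, Set.uIcc_of_le hxy.le, ne_eq, not_not] at h
    obtain ⟨z, ⟨hxz, hzy⟩, hz⟩ := h
    have hTz := (hT z).2 hz
    rcases hxz.eq_or_lt with rfl | hxz
    · rw [gapFlip_of_eq hz]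
      exact lt_gapFlip hF1 hfix hT hTz (hTm hxy)
    refine (gapFlip_lt hF1 hfix hT hTz (hTm hxz)).trans_le ?_
    rcases hzy.eq_or_lt with rfl | hzy
    · rw [gapFlip_of_eq hz]
    · exact (lt_gapFlip hF1 hfix hT hTz (hTm hzy)).le

lemma gapFlip_strictAnti (hF1 : ∀ x, F (x + 1) = F x + 1) (hfix : ∃ p, F p = p)
    (hTm : StrictAnti T) (hTsurj : Function.Surjective T)
    (hT : ∀ x, F (T x) = T x ↔ F x = x) (hlt : ∀ x, x < F x → T x < F (T x))
    (hgt : ∀ x, F x < x → F (T x) < T x) : StrictAnti (gapFlip F T) := by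
  intro x y hxy
  by_cases h : SameGap F x y
  · rw [gapFlip_of_ne h.left, gapFlip_of_ne h.right,
      ← (h.map (Or.inr hTm) hTsurj hT).gapMid_eq]
    rcases h.left.lt_or_gt with hx | hx
    · exact orbitCurve_gapMid_strictAnti hF1 hfix (hgt x hx)
        (neg_lt_neg (gapCoord_lt_gapCoord' hF1 hfix h hx hxy))
    · exact orbitCurve_gapMid_strictMono hF1 hfix (hlt x hx)
        (neg_lt_neg (gapCoord_lt_gapCoord hF1 hfix h hx hxy))
  · simp only [SameGap, not_forall, Set.uIcc_of_le hxy.le, ne_eq, not_not] at h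
    obtain ⟨z, ⟨hxz, hzy⟩, hz⟩ := h
    have hTz := (hT z).2 hz
    rcases hxz.eq_or_lt with rfl | hxz
    · rw [gapFlip_of_eq hz]
      exact gapFlip_lt hF1 hfix hT hTz (hTm hxy)
    refine lt_of_le_of_lt ?_ (lt_gapFlip hF1 hfix hT hTz (hTm hxz))
    rcases hzy.eq_or_lt with rfl | hzy
    · rw [gapFlip_of_eq hz]
    · exact (gapFlip_lt hF1 hfix hT hTz (hTm hzy)).le

end GapFlip

/-- A homeomorphism of the line of translation number `1 / 2` can be replaced by a square root of
the unit translation built out of it and its inverse. -/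
lemma exists_strictMono_sqrt_translate {H : ℝ ≃o ℝ} (hH1 : ∀ x, H (x + 1) = H x + 1) {p : ℝ}
    (hp : H (H p) = p + 1) :
    ∃ T : ℝ → ℝ, StrictMono T ∧ (∀ x, T (x + 1) = T x + 1) ∧ (∀ x, T (T x) = x + 1) ∧
      ∀ x, T x = H x ∨ T x = H.symm x + 1 := by
  set q := H p with hq
  have hpq : p < q := by
    by_contra! h
    linarith [H.monotone h]
  have hqp : q < p + 1 := by
    by_contra! h
    have := H.monotone h
    rw [hH1] at this
    linarith
  set T : ℝ → ℝ := fun x ↦ if Int.fract (x - p) < q - p then H x else H.symm x + 1 with hTdef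
  have hfloor {x : ℝ} {n : ℤ} (h1 : p + n ≤ x) (h2 : x < p + n + 1) :
      Int.fract (x - p) = x - p - n := by
    rw [Int.fract, Int.floor_eq_iff.2 ⟨by linarith, by linarith⟩]
  have hH (x : ℝ) (n : ℤ) : H (x + n) = H x + n := by simpa using map_add_intCast hH1 x n
  have hA {x : ℝ} {n : ℤ} (h1 : p + n ≤ x) (h2 : x < q + n) :
      T x = H x ∧ q + n ≤ T x ∧ T x < p + n + 1 := by
    have hTx : T x = H x := if_pos (by rw [hfloor h1 (by linarith)]; linarith)
    have h3 := H.monotone h1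
    have h4 := H.strictMono h2
    rw [hH] at h3 h4
    exact ⟨hTx, by linarith, by linarith⟩
  have hB {x : ℝ} {n : ℤ} (h1 : q + n ≤ x) (h2 : x < p + n + 1) :
      T x = H.symm x + 1 ∧ p + n + 1 ≤ T x ∧ T x < q + n + 1 := by
    have hTx : T x = H.symm x + 1 :=
      if_neg (by rw [hfloor (by linarith) h2]; linarith)
    have h3 : p + n ≤ H.symm x := by rw [H.le_symm_apply, hH]; exact h1
    have h4 : H.symm x < q + n := by rw [H.symm_apply_lt, hH]; linarith
    exact ⟨hTx, by linarith, by linarith⟩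
  have hcases (x : ℝ) : ∃ n : ℤ, (p + n ≤ x ∧ x < q + n) ∨ (q + n ≤ x ∧ x < p + n + 1) := by
    refine ⟨⌊x - p⌋, ?_⟩
    have h1 := Int.floor_le (x - p)
    have h2 := Int.lt_floor_add_one (x - p)
    rcases lt_or_ge x (q + ⌊x - p⌋) with h | h
    · exact Or.inl ⟨by linarith, h⟩
    · exact Or.inr ⟨h, by linarith⟩
  refine ⟨T, fun x y hxy ↦ ?_, fun x ↦ ?_, fun x ↦ ?_, fun x ↦ ?_⟩
  · obtain ⟨n, hn⟩ := hcases x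
    obtain ⟨m, hm⟩ := hcases y
    have hnm : n ≤ m := by
      have : (n : ℝ) < m + 1 := by
        rcases hn with hn | hn <;> rcases hm with hm | hm <;> linarith [hn.1, hm.2]
      exact_mod_cast Int.lt_add_one_iff.1 (by exact_mod_cast this)
    rcases hnm.eq_or_lt with rfl | hnm
    · rcases hn with hn | hn <;> rcases hm with hm | hm
      · rw [(hA hn.1 hn.2).1, (hA hm.1 hm.2).1]
        exact H.strictMono hxy
      · linarith [(hA hn.1 hn.2).2.2, (hB hm.1 hm.2).2.1]
      · linarith [hn.1, hm.2]
      · rw [(hB hn.1 hn.2).1, (hB hm.1 hm.2).1]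
        linarith [H.symm.strictMono hxy]
    · have : (n : ℝ) + 1 ≤ m := by exact_mod_cast hnm
      have hx : T x < q + n + 1 := by
        rcases hn with hn | hn
        · linarith [(hA hn.1 hn.2).2.2]
        · exact (hB hn.1 hn.2).2.2
      have hy : q + m ≤ T y := by
        rcases hm with hm | hm
        · exact (hA hm.1 hm.2).2.1
        · linarith [(hB hm.1 hm.2).2.1]
      linarith
  · have hs : H.symm (x + 1) = H.symm x + 1 := by
      rw [H.symm_apply_eq, hH1, H.apply_symm_apply]
    have hf : Int.fract (x + 1 - p) = Int.fract (x - p) := by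
      rw [add_sub_right_comm, Int.fract_add_one]
    simp only [hTdef, hf, hs, hH1]
    split_ifs <;> rfl
  · obtain ⟨n, hn | hn⟩ := hcases x
    · obtain ⟨h1, h2, h3⟩ := hA hn.1 hn.2
      rw [(hB h2 h3).1, h1, H.symm_apply_apply]
    · obtain ⟨h1, h2, h3⟩ := hB hn.1 hn.2
      have h4 : p + ((n + 1 : ℤ) : ℝ) ≤ T x := by push_cast; linarith
      have h5 : T x < q + ((n + 1 : ℤ) : ℝ) := by push_cast; linarith
      rw [(hA h4 h5).1, h1, hH1, H.apply_symm_apply]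
  · simp only [hTdef]
    split_ifs <;> simp

/-- The maximum of a decreasing bijection and its inverse is an involution, because the region
under its graph is symmetric about the diagonal. -/
lemma exists_strictAnti_involution {H : ℝ ≃ ℝ} (hH : StrictAnti H)
    (hH1 : ∀ x, H (x + 1) = H x - 1) :
    ∃ T : ℝ → ℝ, StrictAnti T ∧ (∀ x, T (x + 1) = T x - 1) ∧ (∀ x, T (T x) = x) ∧
      ∀ x, T x = H x ∨ T x = H.symm x := by
  have hs : StrictAnti H.symm := fun x y hxy ↦ by
    rwa [← hH.lt_iff_gt, H.apply_symm_apply, H.apply_symm_apply]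
  have hs1 (x : ℝ) : H.symm (x + 1) = H.symm x - 1 := by
    rw [H.symm_apply_eq]
    have := hH1 (H.symm x - 1)
    rw [sub_add_cancel, H.apply_symm_apply] at this
    linarith
  refine ⟨fun x ↦ max (H x) (H.symm x), fun x y hxy ↦ max_lt_max (hH hxy) (hs hxy),
    fun x ↦ by simp only [hH1, hs1, max_sub_sub_right], fun x ↦ ?_, fun x ↦ max_choice _ _⟩
  rcases le_total (H.symm x) (H x) with h | h
  · have := hH.antitone h
    simp_all
  · have := hs.antitone h
    simp_all

lemma sign_eq_sign {a b : ℝ} (h : Real.sign a = Real.sign b) :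
    (b = 0 ↔ a = 0) ∧ (0 < a → 0 < b) ∧ (a < 0 → b < 0) := by
  unfold Real.sign at h
  split_ifs at h <;> grind

lemma sign_eq_neg_sign {a b : ℝ} (h : Real.sign a = -Real.sign b) :
    (b = 0 ↔ a = 0) ∧ (0 < a → b < 0) ∧ (a < 0 → 0 < b) := by
  rw [← Real.sign_neg] at h
  simpa using sign_eq_sign h

lemma coe_eq_coe_iff_exists_int {x y : ℝ} : (x : S1) = y ↔ ∃ n : ℤ, x = y + n := by
  rw [← sub_eq_zero, ← AddCircle.coe_sub, AddCircle.coe_eq_zero_iff]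
  simp only [zsmul_eq_mul, mul_one]
  exact exists_congr fun n ↦ ⟨fun h ↦ by linarith, fun h ↦ by linarith⟩

lemma exists_int_forall_eq_add {u v : ℝ → ℝ} (hu : Continuous u) (hv : Continuous v)
    (h : ∀ x, (u x : S1) = v x) : ∃ n : ℤ, ∀ x, u x = v x + n := by
  choose n hn using fun x ↦ coe_eq_coe_iff_exists_int.1 (h x)
  have hc : Continuous n := by
    rw [Int.isClosedEmbedding_coe_real.continuous_iff]
    refine (hu.sub hv).congr fun x ↦ ?_
    simp [hn x]
  exact ⟨n 0, fun x ↦ by rw [hn x, PreconnectedSpace.constant inferInstance hc (x := x) (y := 0)]⟩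

lemma signature_coe (F : CircleDeg1Lift) (x : ℝ) : signature F x = Real.sign (F x - x) := by
  have : rep x = Int.fract x := by
    simp [rep]
  rw [signature, this, F.map_fract_sub_fract_eq]

lemma exists_continuous_lift (τ : S1 ≃ₜ S1) :
    ∃ T : ℝ → ℝ, Continuous T ∧ ∀ x : ℝ, τ (x : S1) = (T x : S1) := by
  obtain ⟨e, he⟩ := QuotientAddGroup.mk_surjective (τ ((0 : ℝ) : S1))
  let g : C(ℝ, S1) := ⟨fun x ↦ τ (x : S1), τ.continuous.comp (AddCircle.continuous_mk' 1)⟩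
  obtain ⟨T, ⟨-, hT⟩, -⟩ :=
    (AddCircle.isCoveringMap_coe (1 : ℝ)).existsUnique_continuousMap_lifts g 0 e he
  exact ⟨T, T.continuous, fun x ↦ (congr_fun hT x).symm⟩

lemma lift_add_one {τ : S1 ≃ₜ S1} {T : ℝ → ℝ} (hT : Continuous T)
    (hτ : ∀ x : ℝ, τ (x : S1) = (T x : S1)) : ∃ d : ℤ, ∀ x, T (x + 1) = T x + d :=
  exists_int_forall_eq_add (hT.comp (continuous_id.add continuous_const)) hT fun x ↦ by
    rw [← hτ, ← hτ]; simp

/-- Every circle homeomorphism has a lift which is increasing of degree one or decreasing of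
degree minus one. -/
lemma exists_lift_strictMono_or_strictAnti (τ : S1 ≃ₜ S1) :
    ∃ T : ℝ → ℝ, Continuous T ∧ (∀ x : ℝ, τ (x : S1) = (T x : S1)) ∧
      ((StrictMono T ∧ ∀ x, T (x + 1) = T x + 1) ∨ (StrictAnti T ∧ ∀ x, T (x + 1) = T x - 1)) := by
  obtain ⟨T, hTc, hT⟩ := exists_continuous_lift τ
  obtain ⟨U, hUc, hU⟩ := exists_continuous_lift τ.symm
  obtain ⟨d, hd⟩ := lift_add_one hTc hT
  obtain ⟨e, he⟩ := lift_add_one hUc hU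
  obtain ⟨c, hc⟩ := exists_int_forall_eq_add (hUc.comp hTc) continuous_id fun x ↦ by
    simp [← hU, ← hT]
  simp only [Function.comp_apply, id] at hc
  have hinj : Function.Injective T := fun x y hxy ↦ by
    have := hc x
    rw [hxy, hc y] at this
    linarith
  have hde : d * e = 1 := by
    have h1 := hc (0 + 1)
    rw [hd, map_add_intCast he, hc] at h1
    have : (d : ℝ) * e = 1 := by linarith
    exact_mod_cast this
  refine ⟨T, hTc, hT, (hTc.strictMono_of_inj hinj).imp (fun h ↦ ⟨h, ?_⟩) fun h ↦ ⟨h, ?_⟩⟩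
  · have h0 := h (lt_add_one (0 : ℝ))
    rw [hd] at h0
    rcases Int.eq_one_or_neg_one_of_mul_eq_one hde with rfl | rfl
    · simpa using hd
    · norm_num at h0
  · have h0 := h (lt_add_one (0 : ℝ))
    rw [hd] at h0
    rcases Int.eq_one_or_neg_one_of_mul_eq_one hde with rfl | rfl
    · norm_num at h0
    · simpa [sub_eq_add_neg] using hd

lemma bijective_of_lift {τ : S1 ≃ₜ S1} {T : ℝ → ℝ} {d : ℤ} (hd : d * d = 1)
    (hT1 : ∀ x, T (x + 1) = T x + d) (hτ : ∀ x : ℝ, τ (x : S1) = (T x : S1)) :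
    Function.Bijective T := by
  have hd' : (d : ℝ) * d = 1 := by exact_mod_cast hd
  constructor
  · intro x y hxy
    obtain ⟨n, rfl⟩ := coe_eq_coe_iff_exists_int.1
      (τ.injective ((hτ x).trans ((congr_arg _ hxy).trans (hτ y).symm)))
    rw [map_add_intCast hT1, add_eq_left] at hxy
    have : (n : ℝ) = 0 := by linear_combination (d : ℝ) * hxy - n * hd'
    rw [this, add_zero]
  · intro y
    obtain ⟨x, hx⟩ := QuotientAddGroup.mk_surjective (τ.symm (y : S1))
    have hy : τ (x : S1) = y := by
      rw [show (x : S1) = τ.symm (y : S1) from hx, τ.apply_symm_apply]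
    rw [hτ, eq_comm, coe_eq_coe_iff_exists_int] at hy
    obtain ⟨n, rfl⟩ := hy
    refine ⟨x + (n * d : ℤ), ?_⟩
    rw [map_add_intCast hT1]
    push_cast
    linear_combination (n : ℝ) * hd'

lemma exists_orderIso_of_isLiftOf {f : S1 ≃ₜ S1} {F : CircleDeg1Lift} (hF : IsLiftOf f F) :
    ∃ G : ℝ ≃o ℝ, ∀ x, G x = F x := by
  have hb := bijective_of_lift (d := 1) rfl (by simp) hF
  exact ⟨(F.monotone.strictMono_of_injective hb.1).orderIsoOfSurjective F hb.2, fun _ ↦ rfl⟩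

lemma exists_involution_of_lift {T : ℝ → ℝ} (hT : Continuous T) {d k : ℤ}
    (hT1 : ∀ x, T (x + 1) = T x + d) (hTT : ∀ x, T (T x) = x + k) :
    ∃ τ : S1 ≃ₜ S1, IsInvolution τ ∧ ∀ x : ℝ, τ (x : S1) = (T x : S1) := by
  have hper : Function.Periodic (fun x ↦ (T x : S1)) 1 := fun x ↦
    coe_eq_coe_iff_exists_int.2 ⟨d, hT1 x⟩
  let g : S1 → S1 := hper.lift
  have hg (x : ℝ) : g x = T x := rfl
  have hgc : Continuous g := ((AddCircle.continuous_mk' 1).comp hT).quotient_lift _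
  have hgg (x : S1) : g (g x) = x := by
    obtain ⟨x, rfl⟩ := QuotientAddGroup.mk_surjective x
    exact coe_eq_coe_iff_exists_int.2 ⟨k, hTT x⟩
  exact ⟨⟨⟨g, g, hgg, hgg⟩, hgc, hgc⟩, hgg, hg⟩

lemma stronglyReversible_of_strictMono_or_strictAnti {f : S1 ≃ₜ S1} {G : ℝ ≃o ℝ}
    (hf : ∀ x : ℝ, f (x : S1) = (G x : S1)) (hG1 : ∀ x, G (x + 1) = G x + 1)
    (hfix : ∃ p, G p = p) {T : ℝ → ℝ} {d k : ℤ} (hT1 : ∀ x, T (x + 1) = T x + d)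
    (hTT : ∀ x, T (T x) = x + k)
    (hT : (StrictMono T ∧ ∀ x, Real.sign (G x - x) = -Real.sign (G (T x) - T x)) ∨
      (StrictAnti T ∧ ∀ x, Real.sign (G x - x) = Real.sign (G (T x) - T x))) :
    StronglyReversible f := by
  have hfixT (x : ℝ) : G (T x) = T x ↔ G x = x := by
    rw [← sub_eq_zero, ← sub_eq_zero (a := G x)]
    rcases hT with ⟨-, h⟩ | ⟨-, h⟩
    · exact (sign_eq_neg_sign (h x)).1
    · exact (sign_eq_sign (h x)).1
  have hinj := hT.imp And.left And.left
  have hsurj {T : ℝ → ℝ} (hTT : ∀ x, T (T x) = x + k) : Function.Surjective T := fun y ↦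
    ⟨T (y - k), by rw [hTT, sub_add_cancel]⟩
  have hUU := gapFlip_gapFlip hG1 hfix hinj hfixT hTT
  have hUc : Continuous (gapFlip G T) := by
    rcases hT with ⟨hm, h⟩ | ⟨hm, h⟩
    · refine (gapFlip_strictMono hG1 hfix hm (hsurj hTT) hfixT (fun x hx ↦ ?_)
        fun x hx ↦ ?_).monotone.continuous_of_surjective (hsurj hUU)
      · exact sub_neg.1 ((sign_eq_neg_sign (h x)).2.1 (sub_pos.2 hx))
      · exact sub_pos.1 ((sign_eq_neg_sign (h x)).2.2 (sub_neg.2 hx))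
    · have hU := gapFlip_strictAnti hG1 hfix hm (hsurj hTT) hfixT
        (fun x hx ↦ sub_pos.1 ((sign_eq_sign (h x)).2.1 (sub_pos.2 hx)))
        fun x hx ↦ sub_neg.1 ((sign_eq_sign (h x)).2.2 (sub_neg.2 hx))
      have := hU.antitone.neg.continuous_of_surjective
        ((Equiv.neg ℝ).surjective.comp (hsurj hUU))
      exact continuous_neg_iff.1 this
  obtain ⟨τ, hτ, hτU⟩ := exists_involution_of_lift hUc (gapFlip_add_one hG1 hfix hT1) hUU
  refine ⟨τ, hτ, fun x ↦ ?_⟩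
  obtain ⟨y, rfl⟩ := τ.surjective x
  obtain ⟨y, rfl⟩ := QuotientAddGroup.mk_surjective y
  have hy : f (τ (f (y : S1))) = τ (y : S1) := by
    rw [hf, hτU, hf, hτU, apply_gapFlip_apply hG1 hfix hinj (hsurj hTT) hfixT]
  rw [f.eq_symm_apply, hτ]
  exact hy

/-- If `τ` reverses `f`, then a lift of `τ` reverses the lift of `f` with a fixed point. -/
lemma apply_lift_apply {f τ : S1 ≃ₜ S1} {G : ℝ ≃o ℝ} (hf : ∀ x : ℝ, f (x : S1) = (G x : S1))
    (hG1 : ∀ x, G (x + 1) = G x + 1) (hfix : ∃ p, G p = p) {T : ℝ → ℝ} (hTc : Continuous T)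
    (hT : ∀ x : ℝ, τ (x : S1) = (T x : S1)) (hτ : IsInvolution τ)
    (hrev : ∀ x, τ (f (τ x)) = f.symm x) (x : ℝ) : G (T (G x)) = T x := by
  obtain ⟨n, hn⟩ := exists_int_forall_eq_add (G.continuous.comp (hTc.comp G.continuous)) hTc
    fun y ↦ by
      have h := hrev (τ (y : S1))
      rw [hτ, f.eq_symm_apply] at h
      simp only [Function.comp_apply, ← hf, ← hT, h]
  simp only [Function.comp_apply] at hn
  obtain ⟨p, hp⟩ := hfix
  have hm := map_add_intCast hG1 p ⌊T p - p⌋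
  have h1 := Int.floor_le (T p - p)
  have h2 := Int.lt_floor_add_one (T p - p)
  have h3 : G (p + ⌊T p - p⌋) ≤ G (T p) := G.monotone (by linarith)
  have h4 : G (T p) < G (p + ⌊T p - p⌋ + 1) := G.strictMono (by linarith)
  rw [hG1] at h4
  have h5 := hn p
  rw [hp] at h5
  have h6 : n < 1 := by exact_mod_cast (by linarith : (n : ℝ) < 1)
  have h7 : -1 < n := by exact_mod_cast (by linarith : (-1 : ℝ) < n)
  obtain rfl : n = 0 := by omega
  simpa using hn x

lemma sign_lift_of_strictMono {G : ℝ ≃o ℝ} {T : ℝ → ℝ} (hT : StrictMono T)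
    (h : ∀ x, G (T (G x)) = T x) (x : ℝ) :
    Real.sign (G x - x) = -Real.sign (G (T x) - T x) := by
  have hx := h x
  rcases lt_trichotomy (G x) x with hlt | heq | hgt
  · have := G.strictMono (hT hlt)
    rw [Real.sign_of_neg (by linarith), Real.sign_of_pos (by linarith)]
  · rw [heq] at hx
    simp [heq, hx]
  · have := G.strictMono (hT hgt)
    rw [Real.sign_of_pos (by linarith), Real.sign_of_neg (by linarith), neg_neg]

lemma sign_lift_of_strictAnti {G : ℝ ≃o ℝ} {T : ℝ → ℝ} (hT : StrictAnti T)
    (h : ∀ x, G (T (G x)) = T x) (x : ℝ) :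
    Real.sign (G x - x) = Real.sign (G (T x) - T x) := by
  have hx := h x
  rcases lt_trichotomy (G x) x with hlt | heq | hgt
  · have := G.strictMono (hT hlt)
    rw [Real.sign_of_neg (by linarith), Real.sign_of_neg (by linarith)]
  · rw [heq] at hx
    simp [heq, hx]
  · have := G.strictMono (hT hgt)
    rw [Real.sign_of_pos (by linarith), Real.sign_of_pos (by linarith)]

lemma exists_hasRotationNumber_half :
    ∃ h : S1 ≃ₜ S1, OrientationPreserving h ∧ HasRotationNumber h (1 / 2) := by
  have h : IsLiftOf (Homeomorph.addLeft (((1 / 2 : ℝ) : ℝ) : S1))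
      (CircleDeg1Lift.translate (Multiplicative.ofAdd (1 / 2 : ℝ))) := fun x ↦ by
    simp [CircleDeg1Lift.translate_apply]
  exact ⟨_, ⟨_, h⟩, _, h, CircleDeg1Lift.translationNumber_translate _⟩

/-- An increasing lift of an involution is either a lift of the identity or has half-integer
translation number. -/
lemma eq_self_or_hasRotationNumber_half {τ : S1 ≃ₜ S1} (hτ : IsInvolution τ) {U : CircleDeg1Lift}
    (hUc : Continuous U) (hU : IsLiftOf τ U) :
    (∃ j : ℤ, ∀ x, U x = x + j) ∨ HasRotationNumber τ (1 / 2) := by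
  obtain ⟨k, hk⟩ := exists_int_forall_eq_add (hUc.comp hUc) continuous_id fun x ↦ by
    simp only [Function.comp_apply, id, ← hU _, hτ _]
  simp only [Function.comp_apply, id] at hk
  rcases Int.even_or_odd' k with ⟨j, rfl | rfl⟩ <;> push_cast at hk
  · refine Or.inl ⟨j, fun x ↦ ?_⟩
    have h1 := hk x
    rcases lt_trichotomy (U x) (x + j) with h | h | h
    · have := U.monotone h.le
      rw [U.map_add_int] at this
      linarith
    · exact h
    · have := U.monotone h.le
      rw [U.map_add_int] at this
      linarith
  · refine Or.inr ⟨CircleDeg1Lift.translate (Multiplicative.ofAdd (-j : ℝ)) * U, fun x ↦ ?_, ?_⟩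
    · rw [hU, coe_eq_coe_iff_exists_int]
      exact ⟨j, by simp⟩
    · set V := CircleDeg1Lift.translate (Multiplicative.ofAdd (-j : ℝ)) * U with hV
      have hVx (x : ℝ) : V x = U x - j := by
        simp [hV, sub_eq_neg_add]
      have h2 : (V ^ 2) 0 = 0 + ((1 : ℤ) : ℝ) := by
        rw [pow_two, CircleDeg1Lift.mul_apply, hVx, hVx, U.map_sub_int, hk]
        push_cast; ring
      have h3 := CircleDeg1Lift.translationNumber_of_eq_add_int _ h2
      rw [CircleDeg1Lift.translationNumber_pow] at h3
      push_cast at h3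
      linarith

/-- An orientation preserving circle homeomorphism `f` with a fixed point (with lift `F`
fixing a point, so that `signature F = Δ_f`) is strongly reversible in `Homeo(S¹)` iff
there is a homeomorphism `h` with `Δ_f = -deg h • (Δ_f ∘ h)` where either `h` preserves
orientation and has rotation number `1/2`, or `h` reverses orientation. -/
theorem stmt15 (f : S1 ≃ₜ S1) (hf : OrientationPreserving f)
    (F : CircleDeg1Lift) (hF : IsLiftOf f F) (hFfix : ∃ x : ℝ, F x = x) :
    StronglyReversible f ↔
      ∃ h : S1 ≃ₜ S1,
        (OrientationPreserving h ∧ HasRotationNumber h (1 / 2) ∧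
          ∀ y : S1, signature F y = -signature F (h y)) ∨
        (OrientationReversing h ∧ ∀ y : S1, signature F y = signature F (h y)) := by
  obtain ⟨G, hG⟩ := exists_orderIso_of_isLiftOf hF
  have hfG (x : ℝ) : f (x : S1) = (G x : S1) := by rw [hF, hG]
  have hG1 (x : ℝ) : G (x + 1) = G x + 1 := by rw [hG, hG, F.map_add_one]
  have hfix : ∃ p, G p = p := by simpa only [hG] using hFfix
  have hsig (x : ℝ) : signature F x = Real.sign (G x - x) := by rw [signature_coe, hG]
  constructor
  · rintro ⟨τ, hτ, hrev⟩
    obtain ⟨T, hTc, hT, ⟨hm, hT1⟩ | ⟨hm, hT1⟩⟩ := exists_lift_strictMono_or_strictAnti τ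
    · let U : CircleDeg1Lift := ⟨⟨T, hm.monotone⟩, hT1⟩
      have hU : IsLiftOf τ U := hT
      have hGTG := apply_lift_apply hfG hG1 hfix hTc hT hτ hrev
      rcases eq_self_or_hasRotationNumber_half hτ (U := U) hTc hU with ⟨j, hj⟩ | hrot
      · have hGid (x : ℝ) : G x = x := by
          have hj' (x : ℝ) : T x = x + j := hj x
          have h1 := hGTG x
          rw [hj', hj', map_add_intCast hG1] at h1
          have h2 : G (G x) = x := by linarith
          rcases lt_trichotomy (G x) x with h | h | h
          · linarith [G.strictMono h]
          · exact h
          · linarith [G.strictMono h]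
        have hsig0 (y : S1) : signature F y = 0 := by
          obtain ⟨y, rfl⟩ := QuotientAddGroup.mk_surjective y
          exact (hsig y).trans (by rw [hGid, sub_self, Real.sign_zero])
        obtain ⟨h, ho, hr⟩ := exists_hasRotationNumber_half
        exact ⟨h, Or.inl ⟨ho, hr, fun y ↦ by rw [hsig0, hsig0, neg_zero]⟩⟩
      · refine ⟨τ, Or.inl ⟨⟨U, hU⟩, hrot, fun y ↦ ?_⟩⟩
        obtain ⟨y, rfl⟩ := QuotientAddGroup.mk_surjective y
        refine (hsig y).trans ((sign_lift_of_strictMono hm hGTG y).trans ?_)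
        rw [← hsig, ← hT]
    · refine ⟨τ, Or.inr ⟨⟨T, hm, hT1, hT⟩, fun y ↦ ?_⟩⟩
      obtain ⟨y, rfl⟩ := QuotientAddGroup.mk_surjective y
      refine (hsig y).trans ((sign_lift_of_strictAnti hm
        (apply_lift_apply hfG hG1 hfix hTc hT hτ hrev) y).trans ?_)
      rw [← hsig, ← hT]
  · rintro ⟨h, ⟨-, ⟨H, hH, hrot⟩, hsign⟩ | ⟨⟨H, hHm, hH1, hH⟩, hsign⟩⟩
    · obtain ⟨K, hK⟩ := exists_orderIso_of_isLiftOf hH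
      have hHc : Continuous H := by
        simpa only [funext hK] using K.continuous
      obtain ⟨p, hp⟩ := ((H ^ 2).translationNumber_eq_int_iff (H.continuous_pow hHc 2) (m := 1)).1
        (by rw [CircleDeg1Lift.translationNumber_pow, hrot]; norm_num)
      have hp' : K (K p) = p + 1 := by
        simpa [pow_two, hK] using hp
      obtain ⟨T, hTm, hT1, hTT, hTK⟩ := exists_strictMono_sqrt_translate
        (fun x ↦ by rw [hK, hK, H.map_add_one]) hp'
      have hsK (x : ℝ) : Real.sign (G x - x) = -Real.sign (G (K x) - K x) := by
        rw [← hsig, ← hsig, hsign, hH, hK]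
      refine stronglyReversible_of_strictMono_or_strictAnti (d := 1) (k := 1) hfG hG1 hfix
        (by simpa using hT1) (by simpa using hTT) (Or.inl ⟨hTm, fun x ↦ ?_⟩)
      rcases hTK x with hx | hx
      · rw [hx, hsK]
      · rw [hx, hG1, add_sub_add_right_eq_sub, hsK (K.symm x), K.apply_symm_apply, neg_neg]
    · let K : ℝ ≃ ℝ := Equiv.ofBijective H
        (bijective_of_lift (d := -1) rfl (by simpa [sub_eq_add_neg] using hH1) hH)
      have hK (x : ℝ) : K x = H x := rfl
      obtain ⟨T, hTm, hT1, hTT, hTK⟩ := exists_strictAnti_involution (H := K) hHm hH1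
      have hsK (x : ℝ) : Real.sign (G x - x) = Real.sign (G (K x) - K x) := by
        rw [← hsig, ← hsig, hsign, hH, hK]
      refine stronglyReversible_of_strictMono_or_strictAnti (d := -1) (k := 0) hfG hG1 hfix
        (by simpa [sub_eq_add_neg] using hT1) (by simpa using hTT) (Or.inr ⟨hTm, fun x ↦ ?_⟩)
      rcases hTK x with hx | hx
      · rw [hx, hsK]
      · rw [hx, hsK (K.symm x), K.apply_symm_apply]
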